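/- arXiv:2107.07070 — 2 statements merged into one kernel-verified Lean document; each statement's English description precedes it below -/
import Mathlib

section
/- Let (u, N, p) be a classical solution of the damped Navier–Stokes–Bardina equations with initial datum u₀ and force f. Then for every t ≥ 0 the energy equality holds: ‖u(t,·)‖²_{L²} + α²‖u(t,·)‖²_{Ḣ¹} + 2ν ∫₀ᵗ ‖u(s,·)‖²_{Ḣ¹} ds + 2να² ∫₀ᵗ ‖u(s,·)‖²_{Ḣ²} ds = ‖u₀‖²_{L²} + α²‖u₀‖²_{Ḣ¹} + 2 ∫₀ᵗ ( ∫_{ℝ³} f·u(s,·) dx + α² ∫_{ℝ³} Df : Du(s,·) dx ) ds − 2β ∫₀ᵗ ( ‖u(s,·)‖²_{L²} + α²‖u(s,·)‖²_{Ḣ¹} ) ds, where Df : Du denotes the Frobenius inner product of the Jacobian matrices. -/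
open MeasureTheory Set

noncomputable section

abbrev V3 : Type := Fin 3 → ℝ

def pd (j : Fin 3) (g : V3 → Fin 3 → ℝ) : V3 → Fin 3 → ℝ :=
  fun x => fderiv ℝ g x (Pi.single j 1)

def pdS (j : Fin 3) (g : V3 → ℝ) : V3 → ℝ :=
  fun x => fderiv ℝ g x (Pi.single j 1)

def L2sq (g : V3 → Fin 3 → ℝ) : ℝ := ∫ x : V3, ∑ i, (g x i)^2
def H1sq (g : V3 → Fin 3 → ℝ) : ℝ := ∫ x : V3, ∑ i, ∑ j, (pd j g x i)^2
def H2sq (g : V3 → Fin 3 → ℝ) : ℝ := ∫ x : V3, ∑ i, ∑ j, ∑ k, (pd k (pd j g) x i)^2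
def H1aSq (α : ℝ) (g : V3 → Fin 3 → ℝ) : ℝ := L2sq g + α^2 * H1sq g

def IsSchwartz {F : Type*} [NormedAddCommGroup F] [NormedSpace ℝ F] (g : V3 → F) : Prop :=
  ContDiff ℝ (⊤ : ℕ∞) g ∧ ∀ (k n : ℕ), ∃ C : ℝ, ∀ x : V3, ‖x‖ ^ k * ‖iteratedFDeriv ℝ n g x‖ ≤ C

def IsForce (f : V3 → Fin 3 → ℝ) : Prop :=
  IsSchwartz f ∧ ∀ x, (∑ j, pd j f x j) = 0

def SchwartzLocBdd {F : Type*} [NormedAddCommGroup F] [NormedSpace ℝ F]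
    (g : ℝ → V3 → F) : Prop :=
  ContDiffOn ℝ (⊤ : ℕ∞) (fun q : ℝ × V3 => g q.1 q.2) (Set.Ici (0:ℝ) ×ˢ Set.univ) ∧
  ∀ T > (0:ℝ), ∀ (k n : ℕ), ∃ C : ℝ, ∀ t ∈ Set.Icc (0:ℝ) T, ∀ x : V3,
    ‖x‖ ^ k * ‖iteratedFDeriv ℝ n (g t) x‖ ≤ C

structure ClassicalSolution (α β ν : ℝ) (u₀ f : V3 → Fin 3 → ℝ) where
  u : ℝ → V3 → Fin 3 → ℝ
  N : ℝ → V3 → Fin 3 → ℝ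
  p : ℝ → V3 → ℝ
  reg_u : SchwartzLocBdd u
  reg_N : SchwartzLocBdd N
  reg_p : SchwartzLocBdd p
  divFree : ∀ t ≥ (0:ℝ), ∀ x, (∑ j, pd j (u t) x j) = 0
  filter : ∀ t ≥ (0:ℝ), ∀ x i, -α^2 * (∑ j, pd j (pd j (N t)) x i) + N t x i
      = ∑ j, u t x j * pd j (u t) x i
  momentum : ∀ t ≥ (0:ℝ), ∀ x i,
      derivWithin (fun s => u s x i) (Set.Ici (0:ℝ)) t + N t x i
        - ν * (∑ j, pd j (pd j (u t)) x i) + pdS i (p t) x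
      = f x i - β * u t x i
  init : ∀ x, u 0 x = u₀ x


/-! ### Differential calculus of smooth functions on `V3` -/

theorem pdS_add {g h : V3 → ℝ} (hg : Differentiable ℝ g) (hh : Differentiable ℝ h) (j : Fin 3)
    (x : V3) : pdS j (fun y => g y + h y) x = pdS j g x + pdS j h x := by
  simp [pdS, fderiv_fun_add (hg x) (hh x)]

theorem pdS_sub {g h : V3 → ℝ} (hg : Differentiable ℝ g) (hh : Differentiable ℝ h) (j : Fin 3)
    (x : V3) : pdS j (fun y => g y - h y) x = pdS j g x - pdS j h x := by
  simp [pdS, fderiv_fun_sub (hg x) (hh x)]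

theorem pdS_const_mul {g : V3 → ℝ} (hg : Differentiable ℝ g) (c : ℝ) (j : Fin 3) (x : V3) :
    pdS j (fun y => c * g y) x = c * pdS j g x := by
  simp [pdS, fderiv_const_mul (hg x)]

theorem pdS_mul {g h : V3 → ℝ} (hg : Differentiable ℝ g) (hh : Differentiable ℝ h) (j : Fin 3)
    (x : V3) : pdS j (fun y => g y * h y) x = g x * pdS j h x + pdS j g x * h x := by
  simp [pdS, fderiv_fun_mul (hg x) (hh x)]
  ring

theorem pdS_sum {ι : Type*} (s : Finset ι) {g : ι → V3 → ℝ} (hg : ∀ i, Differentiable ℝ (g i))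
    (j : Fin 3) (x : V3) : pdS j (fun y => ∑ i ∈ s, g i y) x = ∑ i ∈ s, pdS j (g i) x := by
  simp [pdS, fderiv_fun_sum fun i _ => hg i x]

theorem two_le_smooth : (2 : WithTop ℕ∞) ≤ ((⊤ : ℕ∞) : WithTop ℕ∞) :=
  WithTop.coe_le_coe.2 (le_top : (2 : ℕ∞) ≤ ⊤)

theorem pdS_comm {g : V3 → ℝ} (hg : ContDiff ℝ (⊤ : ℕ∞) g) (j k : Fin 3) (x : V3) :
    pdS j (pdS k g) x = pdS k (pdS j g) x := by
  have hd : DifferentiableAt ℝ (fderiv ℝ g) x :=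
    (hg.fderiv_right (m := 1) (by simpa [one_add_one_eq_two] using two_le_smooth)).differentiable
      one_ne_zero x
  have hs : IsSymmSndFDerivAt ℝ g x :=
    hg.contDiffAt.isSymmSndFDerivAt (by simpa using two_le_smooth)
  have h (a b : Fin 3) : pdS a (pdS b g) x
      = fderiv ℝ (fderiv ℝ g) x (Pi.single a 1) (Pi.single b 1) := by
    unfold pdS
    rw [fderiv_clm_apply hd (differentiableAt_const _)]
    simp
  rw [h, h, hs.eq]

theorem pd_apply {g : V3 → Fin 3 → ℝ} (hg : Differentiable ℝ g) (j i : Fin 3) (x : V3) :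
    pd j g x i = pdS j (fun y => g y i) x := by
  simp only [pd, pdS]
  rw [fderiv_apply (hg x)]
  rfl

/-! ### Spatial slices of time-dependent Schwartz functions -/

section Slices

variable {F : Type*} [NormedAddCommGroup F] [NormedSpace ℝ F]

theorem IsSchwartz.const {g : V3 → F} (hg : IsSchwartz g) : SchwartzLocBdd fun _ => g :=
  ⟨(hg.1.comp contDiff_snd).contDiffOn, fun _ _ k n =>
    (hg.2 k n).imp fun _ hC _ _ x => hC x⟩

theorem SchwartzLocBdd.slice {g : ℝ → V3 → F} (hg : SchwartzLocBdd g) {t : ℝ} (ht : 0 ≤ t) :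
    IsSchwartz (g t) := by
  refine ⟨?_, fun k n => ?_⟩
  · rw [← contDiffOn_univ]
    exact hg.1.comp (f := fun x : V3 => (t, x)) (by fun_prop)
      fun x _ => ⟨ht, mem_univ _⟩
  · obtain ⟨C, hC⟩ := hg.2 (t + 1) (by linarith) k n
    exact ⟨C, hC t ⟨ht, by linarith⟩⟩

theorem IsSchwartz.differentiable {g : V3 → F} (hg : IsSchwartz g) : Differentiable ℝ g :=
  hg.1.differentiable (by simp)

theorem IsSchwartz.integrable {g : V3 → F} (hg : IsSchwartz g) : Integrable g :=
  (SchwartzMap.mk g hg.1 hg.2).integrable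

/-! ### Closure properties -/

theorem SchwartzLocBdd.component {g : ℝ → V3 → Fin 3 → ℝ} (hg : SchwartzLocBdd g) (i : Fin 3) :
    SchwartzLocBdd fun t x => g t x i := by
  refine ⟨contDiffOn_pi.1 hg.1 i, fun T hT k n => ?_⟩
  obtain ⟨C, hC⟩ := hg.2 T hT k n
  refine ⟨‖(ContinuousLinearMap.proj i : (Fin 3 → ℝ) →L[ℝ] ℝ)‖ * C, fun t ht x => ?_⟩
  have h := ContinuousLinearMap.norm_iteratedFDeriv_comp_left
    (ContinuousLinearMap.proj i : (Fin 3 → ℝ) →L[ℝ] ℝ) (hg.slice ht.1).1.contDiffAt (x := x)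
    (n := n) (by exact_mod_cast le_top)
  calc ‖x‖ ^ k * ‖iteratedFDeriv ℝ n (fun x => g t x i) x‖
      ≤ ‖x‖ ^ k * (‖(ContinuousLinearMap.proj i : (Fin 3 → ℝ) →L[ℝ] ℝ)‖
          * ‖iteratedFDeriv ℝ n (g t) x‖) := by gcongr; exact h
    _ = ‖(ContinuousLinearMap.proj i : (Fin 3 → ℝ) →L[ℝ] ℝ)‖
          * (‖x‖ ^ k * ‖iteratedFDeriv ℝ n (g t) x‖) := by ring
    _ ≤ _ := by gcongr; exact hC t ht x

theorem SchwartzLocBdd.add {g h : ℝ → V3 → F} (hg : SchwartzLocBdd g) (hh : SchwartzLocBdd h) :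
    SchwartzLocBdd fun t x => g t x + h t x := by
  refine ⟨hg.1.add hh.1, fun T hT k n => ?_⟩
  obtain ⟨C, hC⟩ := hg.2 T hT k n
  obtain ⟨D, hD⟩ := hh.2 T hT k n
  refine ⟨C + D, fun t ht x => ?_⟩
  rw [fun_iteratedFDeriv_add_apply
    ((hg.slice ht.1).1.contDiffAt.of_le (by exact_mod_cast le_top))
    ((hh.slice ht.1).1.contDiffAt.of_le (by exact_mod_cast le_top))]
  calc _ ≤ ‖x‖ ^ k * (‖iteratedFDeriv ℝ n (g t) x‖ + ‖iteratedFDeriv ℝ n (h t) x‖) := by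
        gcongr; exact norm_add_le _ _
    _ ≤ C + D := by rw [mul_add]; exact add_le_add (hC t ht x) (hD t ht x)

theorem isSchwartz_zero : IsSchwartz fun _ : V3 => (0 : F) :=
  ⟨contDiff_const, fun k n => ⟨0, fun x => by
    rw [show iteratedFDeriv ℝ n (fun _ : V3 => (0 : F)) = 0 from iteratedFDeriv_fun_zero]; simp⟩⟩

theorem SchwartzLocBdd.sum {ι : Type*} (s : Finset ι) {g : ι → ℝ → V3 → F}
    (hg : ∀ i, SchwartzLocBdd (g i)) : SchwartzLocBdd fun t x => ∑ i ∈ s, g i t x := by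
  classical
  induction s using Finset.induction_on with
  | empty => simpa using isSchwartz_zero.const
  | insert a s ha ih => simpa only [Finset.sum_insert ha] using (hg a).add ih

end Slices

theorem SchwartzLocBdd.mul {g h : ℝ → V3 → ℝ} (hg : SchwartzLocBdd g) (hh : SchwartzLocBdd h) :
    SchwartzLocBdd fun t x => g t x * h t x := by
  refine ⟨hg.1.mul hh.1, fun T hT k n => ?_⟩
  choose C hC using fun i => hg.2 T hT k i
  choose D hD using fun i => hh.2 T hT 0 i
  refine ⟨∑ i ∈ Finset.range (n + 1), (n.choose i : ℝ) * (C i * D (n - i)), fun t ht x => ?_⟩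
  calc _ ≤ ‖x‖ ^ k * ∑ i ∈ Finset.range (n + 1), (n.choose i : ℝ)
          * ‖iteratedFDeriv ℝ i (g t) x‖ * ‖iteratedFDeriv ℝ (n - i) (h t) x‖ := by
        gcongr
        exact norm_iteratedFDeriv_mul_le (hg.slice ht.1).1 (hh.slice ht.1).1 x
          (by exact_mod_cast le_top)
    _ = ∑ i ∈ Finset.range (n + 1), (n.choose i : ℝ) * ((‖x‖ ^ k
          * ‖iteratedFDeriv ℝ i (g t) x‖) * (‖x‖ ^ 0 * ‖iteratedFDeriv ℝ (n - i) (h t) x‖)) := by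
        rw [Finset.mul_sum]; congr with i; ring
    _ ≤ _ := by
        gcongr with i
        · exact (by positivity : (0 : ℝ) ≤ _).trans (hC i t ht x)
        · exact hC i t ht x
        · exact hD _ t ht x

theorem SchwartzLocBdd.const_mul {g : ℝ → V3 → ℝ} (hg : SchwartzLocBdd g) (c : ℝ) :
    SchwartzLocBdd fun t x => c * g t x := by
  refine ⟨contDiffOn_const.mul hg.1, fun T hT k n => ?_⟩
  obtain ⟨C, hC⟩ := hg.2 T hT k n
  refine ⟨|c| * C, fun t ht x => ?_⟩
  have : iteratedFDeriv ℝ n (fun x => c * g t x) x = c • iteratedFDeriv ℝ n (g t) x := by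
    simp_rw [← smul_eq_mul]
    exact iteratedFDeriv_const_smul_apply'
      ((hg.slice ht.1).1.contDiffAt.of_le (by exact_mod_cast le_top))
  rw [this, norm_smul, Real.norm_eq_abs, mul_left_comm]
  gcongr
  exact hC t ht x

theorem SchwartzLocBdd.sub {g h : ℝ → V3 → ℝ} (hg : SchwartzLocBdd g) (hh : SchwartzLocBdd h) :
    SchwartzLocBdd fun t x => g t x - h t x := by
  simpa [sub_eq_add_neg] using hg.add (hh.const_mul (-1))

theorem uniqueDiffOn_spacetime : UniqueDiffOn ℝ (Ici (0 : ℝ) ×ˢ (univ : Set V3)) :=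
  (uniqueDiffOn_Ici 0).prod uniqueDiffOn_univ

theorem SchwartzLocBdd.pdS_eq_fderivWithin {g : ℝ → V3 → ℝ} (hg : SchwartzLocBdd g) {t : ℝ}
    (ht : 0 ≤ t) (j : Fin 3) (x : V3) :
    pdS j (g t) x = fderivWithin ℝ (fun q : ℝ × V3 => g q.1 q.2)
      (Ici (0 : ℝ) ×ˢ univ) (t, x) (0, Pi.single j 1) := by
  have h1 := (hg.1.differentiableOn (by simp) (t, x) ⟨ht, mem_univ _⟩).hasFDerivWithinAt
  have h2 : HasFDerivWithinAt (fun y : V3 => (t, y)) (ContinuousLinearMap.inr ℝ ℝ V3) univ x :=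
    (hasFDerivAt_prodMk_right t x).hasFDerivWithinAt
  have h3 := h1.comp x h2 fun y _ => ⟨ht, mem_univ _⟩
  rw [hasFDerivWithinAt_univ] at h3
  have h4 : fderiv ℝ (g t) x = _ := h3.fderiv
  simp [pdS, h4]

theorem SchwartzLocBdd.pdS {g : ℝ → V3 → ℝ} (hg : SchwartzLocBdd g) (j : Fin 3) :
    SchwartzLocBdd fun t => pdS j (g t) := by
  refine ⟨?_, fun T hT k n => ?_⟩
  · refine ContDiffOn.congr (f := fun q : ℝ × V3 => fderivWithin ℝ (fun q : ℝ × V3 => g q.1 q.2)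
      (Ici (0 : ℝ) ×ˢ univ) q (0, Pi.single j 1)) ?_
      fun q hq => hg.pdS_eq_fderivWithin hq.1 j q.2
    exact (hg.1.fderivWithin uniqueDiffOn_spacetime (by simp)).clm_apply contDiffOn_const
  · obtain ⟨C, hC⟩ := hg.2 T hT k (n + 1)
    refine ⟨‖(Pi.single j 1 : V3)‖ * C, fun t ht x => ?_⟩
    have hc : ContDiff ℝ (⊤ : ℕ∞) (fderiv ℝ (g t)) :=
      (hg.slice ht.1).1.fderiv_right (by simp)
    calc _ ≤ ‖x‖ ^ k * (‖(Pi.single j 1 : V3)‖ * ‖iteratedFDeriv ℝ n (fderiv ℝ (g t)) x‖) := by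
          gcongr
          exact norm_iteratedFDeriv_clm_apply_const hc.contDiffAt (by exact_mod_cast le_top)
      _ = ‖(Pi.single j 1 : V3)‖ * (‖x‖ ^ k * ‖iteratedFDeriv ℝ (n + 1) (g t) x‖) := by
          rw [norm_iteratedFDeriv_fderiv]; ring
      _ ≤ _ := by gcongr; exact hC t ht x

theorem IsSchwartz.mul {g h : V3 → ℝ} (hg : IsSchwartz g) (hh : IsSchwartz h) :
    IsSchwartz fun x => g x * h x := (hg.const.mul hh.const).slice le_rfl

theorem IsSchwartz.add {g h : V3 → ℝ} (hg : IsSchwartz g) (hh : IsSchwartz h) :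
    IsSchwartz fun x => g x + h x := (hg.const.add hh.const).slice le_rfl

theorem IsSchwartz.sub {g h : V3 → ℝ} (hg : IsSchwartz g) (hh : IsSchwartz h) :
    IsSchwartz fun x => g x - h x := (hg.const.sub hh.const).slice le_rfl

theorem IsSchwartz.const_mul {g : V3 → ℝ} (hg : IsSchwartz g) (c : ℝ) :
    IsSchwartz fun x => c * g x := (hg.const.const_mul c).slice le_rfl

theorem IsSchwartz.sum {ι : Type*} (s : Finset ι) {g : ι → V3 → ℝ}
    (hg : ∀ i, IsSchwartz (g i)) : IsSchwartz fun x => ∑ i ∈ s, g i x :=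
  (SchwartzLocBdd.sum s fun i => (hg i).const).slice le_rfl

theorem IsSchwartz.pdS {g : V3 → ℝ} (hg : IsSchwartz g) (j : Fin 3) : IsSchwartz (pdS j g) :=
  (hg.const.pdS j).slice le_rfl

/-! ### Integrals in space -/

theorem IsSchwartz.integral_pdS {g : V3 → ℝ} (hg : IsSchwartz g) (j : Fin 3) :
    ∫ x, _root_.pdS j g x = 0 := by
  have h := integral_mul_fderiv_eq_neg_fderiv_mul_of_integrable (μ := volume) (𝕜 := ℝ)
    (f := fun _ : V3 => 1) (g := g) (v := Pi.single j 1) (by simp)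
    (by simp only [one_mul]; exact (hg.pdS j).integrable) (by simpa using hg.integrable)
    (fun _ _ => differentiableAt_const _) fun x _ => hg.differentiable x
  simpa [_root_.pdS] using h

theorem integral_divergence_eq_zero {e : V3 → ℝ} {Φ : Fin 3 → V3 → ℝ}
    (hΦ : ∀ j, IsSchwartz (Φ j)) (he : ∀ x, e x = ∑ j, pdS j (Φ j) x) : ∫ x, e x = 0 := by
  simp_rw [he]
  rw [integral_finsetSum _ fun j _ => ((hΦ j).pdS j).integrable]
  simp [fun j => (hΦ j).integral_pdS j]

theorem SchwartzLocBdd.exists_bound {g : ℝ → V3 → ℝ} (hg : SchwartzLocBdd g) {T : ℝ}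
    (hT : 0 < T) : ∃ b : V3 → ℝ, Integrable b ∧ ∀ t ∈ Icc 0 T, ∀ x, ‖g t x‖ ≤ b x := by
  obtain ⟨C, hC⟩ := hg.2 T hT 0 0
  obtain ⟨D, hD⟩ := hg.2 T hT 4 0
  refine ⟨fun x => 8 * (C + D) * (1 + ‖x‖) ^ (-4 : ℝ),
    (integrable_one_add_norm (by simp; norm_num)).const_mul _, fun t ht x => ?_⟩
  have h1 := hC t ht x
  have h2 := hD t ht x
  simp only [norm_iteratedFDeriv_zero, pow_zero, one_mul] at h1 h2
  have hx : (0 : ℝ) < (1 + ‖x‖) ^ 4 := by positivity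
  beta_reduce
  rw [Real.rpow_neg (by positivity), ← div_eq_mul_inv,
    show ((1 + ‖x‖) ^ (4 : ℝ)) = (1 + ‖x‖) ^ 4 by exact_mod_cast Real.rpow_natCast _ 4,
    le_div_iff₀ hx]
  have h3 : (1 + ‖x‖) ^ 4 ≤ 8 * (1 + ‖x‖ ^ 4) := by
    nlinarith [sq_nonneg (1 - ‖x‖), sq_nonneg (1 - ‖x‖ ^ 2), sq_nonneg (‖x‖ - ‖x‖ ^ 2),
      norm_nonneg x]
  nlinarith [norm_nonneg (g t x), mul_le_mul_of_nonneg_left h3 (norm_nonneg (g t x))]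

theorem SchwartzLocBdd.continuousOn_time {g : ℝ → V3 → ℝ} (hg : SchwartzLocBdd g) (x : V3) :
    ContinuousOn (fun t => g t x) (Ici 0) :=
  hg.1.continuousOn.comp (f := fun t : ℝ => (t, x)) (by fun_prop) fun _ ht => ⟨ht, mem_univ _⟩

theorem SchwartzLocBdd.continuousOn_integral {g : ℝ → V3 → ℝ} (hg : SchwartzLocBdd g) {T : ℝ}
    (hT : 0 < T) : ContinuousOn (fun t => ∫ x, g t x) (Icc 0 T) := by
  obtain ⟨b, hb, hgb⟩ := hg.exists_bound hT
  exact continuousOn_of_dominated (fun t ht => (hg.slice ht.1).integrable.aestronglyMeasurable)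
    (fun t ht => .of_forall (hgb t ht)) hb
    (.of_forall fun x => (hg.continuousOn_time x).mono Icc_subset_Ici_self)

theorem SchwartzLocBdd.intervalIntegrable {g : ℝ → V3 → ℝ} (hg : SchwartzLocBdd g) {T : ℝ}
    (hT : 0 < T) : IntervalIntegrable (fun t => ∫ x, g t x) volume 0 T :=
  ContinuousOn.intervalIntegrable (by rw [uIcc_of_le hT.le]; exact hg.continuousOn_integral hT)

/-! ### Differentiation in time -/

theorem SchwartzLocBdd.integral_sub_eq {g h : ℝ → V3 → ℝ} (hg : SchwartzLocBdd g)
    (hh : SchwartzLocBdd h) (hgh : ∀ t > 0, ∀ x, HasDerivAt (fun s => g s x) (h t x) t) {T : ℝ}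
    (hT : 0 < T) : ∫ t in (0 : ℝ)..T, ∫ x, h t x = (∫ x, g T x) - ∫ x, g 0 x := by
  refine intervalIntegral.integral_eq_sub_of_hasDerivAt_of_le hT.le
    (hg.continuousOn_integral hT) (fun t ht => ?_) (hh.intervalIntegrable hT)
  obtain ⟨b, hb, hhb⟩ := hh.exists_bound hT
  refine (hasDerivAt_integral_of_dominated_loc_of_deriv_le (Ioo_mem_nhds ht.1 ht.2) ?_
    (hg.slice ht.1.le).integrable (hh.slice ht.1.le).integrable.aestronglyMeasurable
    (.of_forall fun x s hs => hhb s (Ioo_subset_Icc_self hs) x) hb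
    (.of_forall fun x s hs => hgh s hs.1 x)).2
  filter_upwards [Ioo_mem_nhds ht.1 ht.2] with s hs
  exact (hg.slice hs.1.le).integrable.aestronglyMeasurable

theorem SchwartzLocBdd.hasDerivAt_pdS {g h : ℝ → V3 → ℝ} (hg : SchwartzLocBdd g)
    (hgh : ∀ t > 0, ∀ x, HasDerivAt (fun s => g s x) (h t x) t) (j : Fin 3) {t : ℝ}
    (ht : 0 < t) (x : V3) : HasDerivAt (fun s => _root_.pdS j (g s) x) (_root_.pdS j (h t) x) t := by
  set U : ℝ × V3 → ℝ := fun q => g q.1 q.2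
  have hU (s : ℝ) (hs : 0 < s) (y : V3) : ContDiffAt ℝ (⊤ : ℕ∞) U (s, y) :=
    hg.1.contDiffAt (prod_mem_nhds (Ici_mem_nhds hs) Filter.univ_mem)
  have hUd (s : ℝ) (hs : 0 < s) (y : V3) : HasFDerivAt U (fderiv ℝ U (s, y)) (s, y) :=
    ((hU s hs y).differentiableAt (by simp)).hasFDerivAt
  have hU2 : HasFDerivAt (fderiv ℝ U) (fderiv ℝ (fderiv ℝ U) (t, x)) (t, x) :=
    (((hU t ht x).fderiv_right (m := 1)
      (by simpa [one_add_one_eq_two] using two_le_smooth)).differentiableAt one_ne_zero).hasFDerivAt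
  have hsymm : IsSymmSndFDerivAt ℝ U (t, x) :=
    (hU t ht x).isSymmSndFDerivAt (by simpa using two_le_smooth)
  have hx (s : ℝ) (hs : 0 < s) : _root_.pdS j (g s) x = fderiv ℝ U (s, x) (0, Pi.single j 1) := by
    have h4 : fderiv ℝ (g s) x = _ :=
      ((hUd s hs x).comp x (hasFDerivAt_prodMk_right s x)).fderiv
    simp [_root_.pdS, h4]
  have ht' (y : V3) : h t y = fderiv ℝ U (t, y) (1, 0) := by
    have h4 := ((hUd t ht y).comp t (hasFDerivAt_prodMk_left t y)).hasDerivAt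
    simpa using (hgh t ht y).unique h4
  have hd : _root_.pdS j (h t) x
      = fderiv ℝ (fderiv ℝ U) (t, x) (0, Pi.single j 1) (1, 0) := by
    have h5 := (hU2.comp x (hasFDerivAt_prodMk_right t x)).clm_apply
      (hasFDerivAt_const ((1 : ℝ), (0 : V3)) x)
    rw [_root_.pdS, show h t = fun y => fderiv ℝ U (t, y) (1, 0) from funext ht']
    have h6 : fderiv ℝ (fun y => fderiv ℝ U (t, y) (1, 0)) x = _ := h5.fderiv
    simp [h6]
  have h7 := ((hU2.comp (f := fun s : ℝ => (s, x)) t (hasFDerivAt_prodMk_left t x)).clm_apply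
      (hasFDerivAt_const ((0 : ℝ), (Pi.single j 1 : V3)) t)).hasDerivAt
  rw [hd, hsymm.eq]
  refine HasDerivAt.congr_of_eventuallyEq (by simpa using h7) ?_
  filter_upwards [Ioi_mem_nhds ht] with s hs using hx s hs

/-! ### Energy identities at a fixed time -/

section FixedTime

variable {v N : Fin 3 → V3 → ℝ}

theorem integral_filtered_nonlinearity (α : ℝ) (hv : ∀ i, IsSchwartz (v i))
    (hN : ∀ i, IsSchwartz (N i)) (hdiv : ∀ x, ∑ j, pdS j (v j) x = 0)
    (hfilter : ∀ x i, -α ^ 2 * (∑ j, pdS j (pdS j (N i)) x) + N i x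
      = ∑ j, v j x * pdS j (v i) x) :
    ∫ x, ∑ i, (v i x * N i x + α ^ 2 * ∑ j, pdS j (v i) x * pdS j (N i) x) = 0 := by
  have h1 (i j : Fin 3) : IsSchwartz fun y => v i y * pdS j (N i) y := (hv i).mul ((hN i).pdS j)
  have h2 (i j : Fin 3) : IsSchwartz fun y => v j y * (v i y * v i y) :=
    (hv j).mul ((hv i).mul (hv i))
  have h3 (i j : Fin 3) : IsSchwartz fun y =>
      α ^ 2 * (v i y * pdS j (N i) y) + 1 / 2 * (v j y * (v i y * v i y)) :=
    ((h1 i j).const_mul _).add ((h2 i j).const_mul _)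
  refine integral_divergence_eq_zero (Φ := fun j y => ∑ i,
    (α ^ 2 * (v i y * pdS j (N i) y) + 1 / 2 * (v j y * (v i y * v i y))))
    (fun j => .sum _ fun i => h3 i j) fun x => ?_
  have hΦ (j : Fin 3) : pdS j (fun y => ∑ i,
      (α ^ 2 * (v i y * pdS j (N i) y) + 1 / 2 * (v j y * (v i y * v i y)))) x
      = ∑ i, (α ^ 2 * (v i x * pdS j (pdS j (N i)) x + pdS j (v i) x * pdS j (N i) x)
        + 1 / 2 * (v j x * (v i x * pdS j (v i) x + pdS j (v i) x * v i x)
          + pdS j (v j) x * (v i x * v i x))) := by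
    rw [pdS_sum _ fun i => (h3 i j).differentiable]
    refine Finset.sum_congr rfl fun i _ => ?_
    rw [pdS_add ((h1 i j).const_mul _).differentiable ((h2 i j).const_mul _).differentiable,
      pdS_const_mul (h1 i j).differentiable, pdS_const_mul (h2 i j).differentiable,
      pdS_mul (hv i).differentiable ((hN i).pdS j).differentiable,
      pdS_mul (hv j).differentiable ((hv i).mul (hv i)).differentiable,
      pdS_mul (hv i).differentiable (hv i).differentiable]
  simp_rw [hΦ]
  have hd := hdiv x
  have hf := hfilter x
  simp only [Fin.sum_univ_three] at hd hf ⊢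
  linear_combination v 0 x * hf 0 + v 1 x * hf 1 + v 2 x * hf 2
    - 1 / 2 * (v 0 x ^ 2 + v 1 x ^ 2 + v 2 x ^ 2) * hd

theorem integral_pressure (α : ℝ) {p : V3 → ℝ} (hv : ∀ i, IsSchwartz (v i))
    (hp : IsSchwartz p) (hdiv : ∀ x, ∑ j, pdS j (v j) x = 0) :
    ∫ x, ∑ i, (v i x * pdS i p x + α ^ 2 * ∑ j, pdS j (v i) x * pdS j (pdS i p) x) = 0 := by
  have h1 (i : Fin 3) : IsSchwartz fun y => v i y * p y := (hv i).mul hp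
  have h2 (i j : Fin 3) : IsSchwartz fun y => pdS j (v i) y * pdS j p y :=
    ((hv i).pdS j).mul (hp.pdS j)
  have h3 (i : Fin 3) : IsSchwartz fun y => ∑ j, pdS j (v i) y * pdS j p y := .sum _ (h2 i)
  refine integral_divergence_eq_zero (Φ := fun i y => v i y * p y
      + α ^ 2 * ∑ j, pdS j (v i) y * pdS j p y)
    (fun i => (h1 i).add ((h3 i).const_mul _)) fun x => ?_
  have hΦ (i : Fin 3) : pdS i (fun y => v i y * p y
      + α ^ 2 * ∑ j, pdS j (v i) y * pdS j p y) x
      = v i x * pdS i p x + pdS i (v i) x * p x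
        + α ^ 2 * ∑ j, (pdS j (v i) x * pdS j (pdS i p) x
          + pdS j (pdS i (v i)) x * pdS j p x) := by
    rw [pdS_add (h1 i).differentiable ((h3 i).const_mul _).differentiable,
      pdS_const_mul (h3 i).differentiable, pdS_mul (hv i).differentiable hp.differentiable,
      pdS_sum _ fun j => (h2 i j).differentiable]
    congr 2
    refine Finset.sum_congr rfl fun j _ => ?_
    rw [pdS_mul ((hv i).pdS j).differentiable (hp.pdS j).differentiable, pdS_comm hp.1 i j,
      pdS_comm (hv i).1 i j]
  have hdd (j : Fin 3) : ∑ i, pdS j (pdS i (v i)) x = 0 := by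
    rw [← pdS_sum _ fun i => ((hv i).pdS i).differentiable, funext hdiv]
    simp [pdS]
  simp_rw [hΦ]
  have hd := hdiv x
  simp only [Fin.sum_univ_three] at hd hdd ⊢
  linear_combination - p x * hd - α ^ 2 * (pdS 0 p x * hdd 0 + pdS 1 p x * hdd 1
    + pdS 2 p x * hdd 2)

theorem integral_viscous (α : ℝ) (hv : ∀ i, IsSchwartz (v i)) :
    ∫ x, ∑ i, (v i x * (∑ k, pdS k (pdS k (v i)) x)
      + α ^ 2 * (∑ j, pdS j (v i) x * ∑ k, pdS j (pdS k (pdS k (v i))) x)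
      + (∑ j, pdS j (v i) x ^ 2) + α ^ 2 * ∑ j, ∑ k, pdS k (pdS j (v i)) x ^ 2) = 0 := by
  have h1 (i k : Fin 3) : IsSchwartz fun y => v i y * pdS k (v i) y := (hv i).mul ((hv i).pdS k)
  have h2 (i j k : Fin 3) : IsSchwartz fun y => pdS j (v i) y * pdS k (pdS j (v i)) y :=
    ((hv i).pdS j).mul (((hv i).pdS j).pdS k)
  have h3 (i k : Fin 3) : IsSchwartz fun y => ∑ j, pdS j (v i) y * pdS k (pdS j (v i)) y :=
    .sum _ fun j => h2 i j k
  have h4 (i k : Fin 3) : IsSchwartz fun y => v i y * pdS k (v i) y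
      + α ^ 2 * ∑ j, pdS j (v i) y * pdS k (pdS j (v i)) y :=
    (h1 i k).add ((h3 i k).const_mul _)
  refine integral_divergence_eq_zero (Φ := fun k y => ∑ i, (v i y * pdS k (v i) y
      + α ^ 2 * ∑ j, pdS j (v i) y * pdS k (pdS j (v i)) y))
    (fun k => .sum _ fun i => h4 i k) fun x => ?_
  have hcomm (i j k : Fin 3) :
      pdS k (pdS k (pdS j (v i))) x = pdS j (pdS k (pdS k (v i))) x := by
    rw [show pdS k (pdS j (v i)) = pdS j (pdS k (v i)) from funext (pdS_comm (hv i).1 k j),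
      pdS_comm ((hv i).pdS k).1]
  have hΦ (k : Fin 3) : pdS k (fun y => ∑ i, (v i y * pdS k (v i) y
      + α ^ 2 * ∑ j, pdS j (v i) y * pdS k (pdS j (v i)) y)) x
      = ∑ i, (v i x * pdS k (pdS k (v i)) x + pdS k (v i) x * pdS k (v i) x
        + α ^ 2 * ∑ j, (pdS j (v i) x * pdS j (pdS k (pdS k (v i))) x
          + pdS k (pdS j (v i)) x * pdS k (pdS j (v i)) x)) := by
    rw [pdS_sum _ fun i => (h4 i k).differentiable]
    refine Finset.sum_congr rfl fun i _ => ?_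
    rw [pdS_add (h1 i k).differentiable ((h3 i k).const_mul _).differentiable,
      pdS_const_mul (h3 i k).differentiable,
      pdS_mul (hv i).differentiable ((hv i).pdS k).differentiable,
      pdS_sum _ fun j => (h2 i j k).differentiable]
    congr 2
    refine Finset.sum_congr rfl fun j _ => ?_
    rw [pdS_mul ((hv i).pdS j).differentiable (((hv i).pdS j).pdS k).differentiable, hcomm]
  simp_rw [hΦ]
  rw [Finset.sum_comm]
  refine Finset.sum_congr rfl fun i _ => ?_
  simp only [Fin.sum_univ_three]
  ring

theorem integral_energy_rate (α β ν : ℝ) {F G : Fin 3 → V3 → ℝ} {p : V3 → ℝ}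
    (hv : ∀ i, IsSchwartz (v i)) (hN : ∀ i, IsSchwartz (N i)) (hF : ∀ i, IsSchwartz (F i))
    (hp : IsSchwartz p) (hdiv : ∀ x, ∑ j, pdS j (v j) x = 0)
    (hfilter : ∀ x i, -α ^ 2 * (∑ j, pdS j (pdS j (N i)) x) + N i x
      = ∑ j, v j x * pdS j (v i) x)
    (hG : ∀ i, G i = fun x => F i x - β * v i x - N i x
      + ν * (∑ k, pdS k (pdS k (v i)) x) - pdS i p x) :
    ∫ x, ∑ i, (v i x * G i x + α ^ 2 * ∑ j, pdS j (v i) x * pdS j (G i) x)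
      = (∫ x, ∑ i, F i x * v i x) + α ^ 2 * (∫ x, ∑ i, ∑ j, pdS j (F i) x * pdS j (v i) x)
        - β * ((∫ x, ∑ i, v i x ^ 2) + α ^ 2 * ∫ x, ∑ i, ∑ j, pdS j (v i) x ^ 2)
        - ν * (∫ x, ∑ i, ∑ j, pdS j (v i) x ^ 2)
        - ν * α ^ 2 * ∫ x, ∑ i, ∑ j, ∑ k, pdS k (pdS j (v i)) x ^ 2 := by
  have hlap (i : Fin 3) : IsSchwartz fun x => ∑ k, pdS k (pdS k (v i)) x :=
    .sum _ fun k => ((hv i).pdS k).pdS k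
  have hGj (i j : Fin 3) (x : V3) : pdS j (G i) x = pdS j (F i) x - β * pdS j (v i) x
      - pdS j (N i) x + ν * (∑ k, pdS j (pdS k (pdS k (v i))) x) - pdS j (pdS i p) x := by
    have h1 := (hv i).const_mul β
    have h2 := (hF i).sub h1
    have h3 := h2.sub (hN i)
    have h4 := (hlap i).const_mul ν
    rw [hG, pdS_sub (h3.add h4).differentiable (hp.pdS i).differentiable,
      pdS_add h3.differentiable h4.differentiable, pdS_sub h2.differentiable (hN i).differentiable,
      pdS_sub (hF i).differentiable h1.differentiable, pdS_const_mul (hv i).differentiable,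
      pdS_const_mul (hlap i).differentiable,
      pdS_sum _ fun k => (((hv i).pdS k).pdS k).differentiable]
  have hforce : IsSchwartz fun x => ∑ i, F i x * v i x := .sum _ fun i => (hF i).mul (hv i)
  have hforce' : IsSchwartz fun x => ∑ i, ∑ j, pdS j (F i) x * pdS j (v i) x :=
    .sum _ fun i => .sum _ fun j => ((hF i).pdS j).mul ((hv i).pdS j)
  have h0 : IsSchwartz fun x => ∑ i, v i x ^ 2 := by
    simp_rw [pow_two]; exact .sum _ fun i => (hv i).mul (hv i)
  have h1 : IsSchwartz fun x => ∑ i, ∑ j, pdS j (v i) x ^ 2 := by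
    simp_rw [pow_two]; exact .sum _ fun i => .sum _ fun j => ((hv i).pdS j).mul ((hv i).pdS j)
  have h2 : IsSchwartz fun x => ∑ i, ∑ j, ∑ k, pdS k (pdS j (v i)) x ^ 2 := by
    simp_rw [pow_two]
    exact .sum _ fun i => .sum _ fun j => .sum _ fun k =>
      (((hv i).pdS j).pdS k).mul (((hv i).pdS j).pdS k)
  have hn : IsSchwartz fun x =>
      ∑ i, (v i x * N i x + α ^ 2 * ∑ j, pdS j (v i) x * pdS j (N i) x) :=
    .sum _ fun i => ((hv i).mul (hN i)).add
      ((IsSchwartz.sum _ fun j => ((hv i).pdS j).mul ((hN i).pdS j)).const_mul _)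
  have hpr : IsSchwartz fun x =>
      ∑ i, (v i x * pdS i p x + α ^ 2 * ∑ j, pdS j (v i) x * pdS j (pdS i p) x) :=
    .sum _ fun i => ((hv i).mul (hp.pdS i)).add
      ((IsSchwartz.sum _ fun j => ((hv i).pdS j).mul ((hp.pdS i).pdS j)).const_mul _)
  have hvisc : IsSchwartz fun x => ∑ i, (v i x * (∑ k, pdS k (pdS k (v i)) x)
      + α ^ 2 * (∑ j, pdS j (v i) x * ∑ k, pdS j (pdS k (pdS k (v i))) x)
      + (∑ j, pdS j (v i) x ^ 2) + α ^ 2 * ∑ j, ∑ k, pdS k (pdS j (v i)) x ^ 2) := by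
    simp_rw [pow_two (pdS _ _ _)]
    exact .sum _ fun i => ((((hv i).mul (hlap i)).add
      ((IsSchwartz.sum _ fun j => ((hv i).pdS j).mul
        (.sum _ fun k => (((hv i).pdS k).pdS k).pdS j)).const_mul _)).add
      (.sum _ fun j => ((hv i).pdS j).mul ((hv i).pdS j))).add
      ((IsSchwartz.sum _ fun j => .sum _ fun k =>
        (((hv i).pdS j).pdS k).mul (((hv i).pdS j).pdS k)).const_mul _)
  have key (x : V3) : ∑ i, (v i x * G i x + α ^ 2 * ∑ j, pdS j (v i) x * pdS j (G i) x)
      = (∑ i, F i x * v i x) + α ^ 2 * (∑ i, ∑ j, pdS j (F i) x * pdS j (v i) x)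
        - β * ((∑ i, v i x ^ 2) + α ^ 2 * ∑ i, ∑ j, pdS j (v i) x ^ 2)
        - ν * (∑ i, ∑ j, pdS j (v i) x ^ 2)
        - ν * α ^ 2 * (∑ i, ∑ j, ∑ k, pdS k (pdS j (v i)) x ^ 2)
        - (∑ i, (v i x * N i x + α ^ 2 * ∑ j, pdS j (v i) x * pdS j (N i) x))
        - (∑ i, (v i x * pdS i p x + α ^ 2 * ∑ j, pdS j (v i) x * pdS j (pdS i p) x))
        + ν * (∑ i, (v i x * (∑ k, pdS k (pdS k (v i)) x)
          + α ^ 2 * (∑ j, pdS j (v i) x * ∑ k, pdS j (pdS k (pdS k (v i))) x)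
          + (∑ j, pdS j (v i) x ^ 2) + α ^ 2 * ∑ j, ∑ k, pdS k (pdS j (v i)) x ^ 2)) := by
    simp_rw [hGj, hG]
    simp only [Finset.mul_sum, ← Finset.sum_add_distrib, ← Finset.sum_sub_distrib]
    refine Finset.sum_congr rfl fun i _ => ?_
    simp only [Fin.sum_univ_three]
    ring
  have s1 := hforce'.const_mul (α ^ 2)
  have s2 := h1.const_mul (α ^ 2)
  have s3 := (h0.add s2).const_mul β
  have s4 := h1.const_mul ν
  have s5 := h2.const_mul (ν * α ^ 2)
  have s6 := hvisc.const_mul ν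
  have t1 := hforce.add s1
  have t2 := t1.sub s3
  have t3 := t2.sub s4
  have t4 := t3.sub s5
  have t5 := t4.sub hn
  have t6 := t5.sub hpr
  simp_rw [key]
  rw [integral_add t6.integrable s6.integrable, integral_sub t5.integrable hpr.integrable,
    integral_sub t4.integrable hn.integrable, integral_sub t3.integrable s5.integrable,
    integral_sub t2.integrable s4.integrable, integral_sub t1.integrable s3.integrable,
    integral_add hforce.integrable s1.integrable, integral_const_mul, integral_const_mul,
    integral_add h0.integrable s2.integrable, integral_const_mul, integral_const_mul,
    integral_const_mul, integral_const_mul, integral_filtered_nonlinearity α hv hN hdiv hfilter,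
    integral_pressure α hv hp hdiv, integral_viscous α hv]
  ring

end FixedTime

/-- Energy equality for classical solutions of the damped Navier–Stokes–Bardina equations. -/
theorem energy_equality (α β ν : ℝ) (hα : 0 < α) (hβ : 0 < β) (hν : 0 < ν)
    (u₀ f : V3 → Fin 3 → ℝ) (hf : IsForce f)
    (sol : ClassicalSolution α β ν u₀ f) (t : ℝ) (ht : 0 ≤ t) :
    L2sq (sol.u t) + α^2 * H1sq (sol.u t)
      + 2 * ν * (∫ s in (0:ℝ)..t, H1sq (sol.u s))
      + 2 * ν * α^2 * (∫ s in (0:ℝ)..t, H2sq (sol.u s))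
    = L2sq u₀ + α^2 * H1sq u₀
      + 2 * (∫ s in (0:ℝ)..t,
          ((∫ x : V3, ∑ i, f x i * sol.u s x i)
            + α^2 * ∫ x : V3, ∑ i, ∑ j, pd j f x i * pd j (sol.u s) x i))
      - 2 * β * (∫ s in (0:ℝ)..t, (L2sq (sol.u s) + α^2 * H1sq (sol.u s))) := by
  rcases ht.eq_or_lt with rfl | hT
  · simp [show sol.u 0 = u₀ from funext sol.init]
  set v : Fin 3 → ℝ → V3 → ℝ := fun i s x => sol.u s x i
  set G : Fin 3 → ℝ → V3 → ℝ := fun i s x => f x i - β * v i s x - sol.N s x i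
    + ν * (∑ k, pdS k (pdS k (v i s)) x) - pdS i (sol.p s) x
  have hv (i) : SchwartzLocBdd (v i) := sol.reg_u.component i
  have hN (i) : SchwartzLocBdd fun s x => sol.N s x i := sol.reg_N.component i
  have hF (i) : SchwartzLocBdd fun (_ : ℝ) x => f x i := hf.1.const.component i
  have hG (i) : SchwartzLocBdd (G i) :=
    ((((hF i).sub ((hv i).const_mul β)).sub (hN i)).add
      ((SchwartzLocBdd.sum _ fun k => ((hv i).pdS k).pdS k).const_mul ν)).sub (sol.reg_p.pdS i)
  have pd_u (s : ℝ) (hs : 0 ≤ s) (j i : Fin 3) (x : V3) : pd j (sol.u s) x i = pdS j (v i s) x :=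
    pd_apply (sol.reg_u.slice hs).differentiable j i x
  have pd_f (j i : Fin 3) (x : V3) : pd j f x i = pdS j (fun y => f y i) x :=
    pd_apply hf.1.differentiable j i x
  have pd_pd {g : V3 → Fin 3 → ℝ} (hg : IsSchwartz g) (k j i : Fin 3) (x : V3) :
      pd k (pd j g) x i = pdS k (pdS j fun y => g y i) x := by
    have hd : Differentiable ℝ (pd j g) := fun y =>
      (((hg.1.fderiv_right (m := (⊤ : ℕ∞)) (by simp)).differentiable (by simp)) y).clm_apply
        (differentiableAt_const _)
    rw [pd_apply hd, funext (pd_apply hg.differentiable j i)]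
  have hderiv (i : Fin 3) (s : ℝ) (hs : s > 0) (x : V3) :
      HasDerivAt (fun r => v i r x) (G i s x) s := by
    have hc : ContDiffAt ℝ (⊤ : ℕ∞) (fun q : ℝ × V3 => v i q.1 q.2) (s, x) :=
      (hv i).1.contDiffAt (prod_mem_nhds (Ici_mem_nhds hs) Filter.univ_mem)
    have hd : DifferentiableAt ℝ (fun r => v i r x) s :=
      (hc.differentiableAt (by simp)).comp (f := fun r : ℝ => (r, x)) s (by fun_prop)
    have hm := sol.momentum s hs.le x i
    simp only [pd_pd (sol.reg_u.slice hs.le)] at hm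
    rw [derivWithin_of_mem_nhds (Ici_mem_nhds hs)] at hm
    refine hd.hasDerivAt.congr_deriv ?_
    change deriv (fun r => sol.u r x i) s = f x i - β * sol.u s x i - sol.N s x i
      + ν * (∑ k, pdS k (pdS k fun y => sol.u s y i) x) - pdS i (sol.p s) x
    linarith
  have hderiv' (i j : Fin 3) (s : ℝ) (hs : s > 0) (x : V3) :
      HasDerivAt (fun r => pdS j (v i r) x) (pdS j (G i s) x) s :=
    (hv i).hasDerivAt_pdS (hderiv i) j hs x
  have hL2 : SchwartzLocBdd fun s x => ∑ i, v i s x ^ 2 := by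
    simp_rw [pow_two]; exact .sum _ fun i => (hv i).mul (hv i)
  have hH1 : SchwartzLocBdd fun s x => ∑ i, ∑ j, pdS j (v i s) x ^ 2 := by
    simp_rw [pow_two]; exact .sum _ fun i => .sum _ fun j => ((hv i).pdS j).mul ((hv i).pdS j)
  have hH2 : SchwartzLocBdd fun s x => ∑ i, ∑ j, ∑ k, pdS k (pdS j (v i s)) x ^ 2 := by
    simp_rw [pow_two]
    exact .sum _ fun i => .sum _ fun j => .sum _ fun k =>
      (((hv i).pdS j).pdS k).mul (((hv i).pdS j).pdS k)
  have hforce : SchwartzLocBdd fun s x => ∑ i, f x i * v i s x :=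
    .sum _ fun i => (hF i).mul (hv i)
  have hforce' : SchwartzLocBdd fun s x =>
      ∑ i, ∑ j, pdS j (fun y => f y i) x * pdS j (v i s) x :=
    .sum _ fun i => .sum _ fun j => ((hF i).pdS j).mul ((hv i).pdS j)
  have eL2 (s : ℝ) : L2sq (sol.u s) = ∫ x, ∑ i, v i s x ^ 2 := rfl
  have eH1 (s : ℝ) (hs : 0 ≤ s) :
      H1sq (sol.u s) = ∫ x, ∑ i, ∑ j, pdS j (v i s) x ^ 2 := by
    simp_rw [H1sq, pd_u s hs]
  have eH2 (s : ℝ) (hs : 0 ≤ s) :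
      H2sq (sol.u s) = ∫ x, ∑ i, ∑ j, ∑ k, pdS k (pdS j (v i s)) x ^ 2 := by
    simp only [H2sq, pd_pd (sol.reg_u.slice hs)]
    rfl
  have hint {g h : ℝ → ℝ} (hg : IntervalIntegrable g volume 0 t)
      (h_eq : ∀ s, 0 ≤ s → h s = g s) : IntervalIntegrable h volume 0 t := by
    refine hg.congr fun s hs => (h_eq s ?_).symm
    rw [uIoc_of_le hT.le] at hs
    exact hs.1.le
  have iL2 : IntervalIntegrable (fun s => L2sq (sol.u s)) volume 0 t :=
    hL2.intervalIntegrable hT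
  have iH1 := hint (hH1.intervalIntegrable hT) eH1
  have iH2 := hint (hH2.intervalIntegrable hT) eH2
  have iforce : IntervalIntegrable (fun s => ∫ x : V3, ∑ i, f x i * sol.u s x i) volume 0 t :=
    hforce.intervalIntegrable hT
  have iforce' := hint (h := fun s => ∫ x : V3, ∑ i, ∑ j, pd j f x i * pd j (sol.u s) x i)
    (hforce'.intervalIntegrable hT) fun s hs => by simp_rw [pd_f, pd_u s hs]
  have henergy : SchwartzLocBdd fun s x =>
      (∑ i, v i s x ^ 2) + α ^ 2 * ∑ i, ∑ j, pdS j (v i s) x ^ 2 := hL2.add (hH1.const_mul _)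
  have hrate : SchwartzLocBdd fun s x =>
      2 * ∑ i, (v i s x * G i s x + α ^ 2 * ∑ j, pdS j (v i s) x * pdS j (G i s) x) :=
    (SchwartzLocBdd.sum _ fun i => ((hv i).mul (hG i)).add
      ((SchwartzLocBdd.sum _ fun j => ((hv i).pdS j).mul ((hG i).pdS j)).const_mul _)).const_mul _
  have hbal := henergy.integral_sub_eq hrate (fun s hs x => by
    have h1 := HasDerivAt.fun_sum (u := Finset.univ) fun i _ => (hderiv i s hs x).fun_pow 2
    have h2 := HasDerivAt.fun_sum (u := Finset.univ) fun i _ =>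
      HasDerivAt.fun_sum (u := Finset.univ) fun j _ => (hderiv' i j s hs x).fun_pow 2
    refine (h1.fun_add (h2.const_mul (α ^ 2))).congr_deriv ?_
    simp only [Fin.sum_univ_three]
    ring) hT
  have eE (s : ℝ) (hs : 0 ≤ s) : ∫ x, ((∑ i, v i s x ^ 2)
      + α ^ 2 * ∑ i, ∑ j, pdS j (v i s) x ^ 2) = L2sq (sol.u s) + α ^ 2 * H1sq (sol.u s) := by
    rw [integral_add (hL2.slice hs).integrable ((hH1.slice hs).const_mul _).integrable,
      integral_const_mul, eL2, eH1 s hs]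
  have erate (s : ℝ) (hs : 0 ≤ s) : ∫ x, 2 * ∑ i, (v i s x * G i s x
      + α ^ 2 * ∑ j, pdS j (v i s) x * pdS j (G i s) x)
      = 2 * ((∫ x : V3, ∑ i, f x i * sol.u s x i)
            + α^2 * ∫ x : V3, ∑ i, ∑ j, pd j f x i * pd j (sol.u s) x i)
        - 2 * β * (L2sq (sol.u s) + α ^ 2 * H1sq (sol.u s)) - 2 * ν * H1sq (sol.u s)
        - 2 * ν * α ^ 2 * H2sq (sol.u s) := by
    rw [integral_const_mul, integral_energy_rate (v := fun i => v i s) (G := fun i => G i s)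
      (N := fun i x => sol.N s x i) (F := fun i x => f x i) (p := sol.p s) α β ν
      (fun i => (hv i).slice hs) (fun i => (hN i).slice hs) (fun i => (hF i).slice hs)
      (sol.reg_p.slice hs) (fun x => by simpa only [pd_u s hs] using sol.divFree s hs x)
      (fun x i => by
        simpa only [pd_u s hs, pd_pd (sol.reg_N.slice hs)] using sol.filter s hs x i)
      fun i => rfl, eL2, eH1 s hs, eH2 s hs]
    simp_rw [pd_f, pd_u s hs]
    ring
  have i1 := (iforce.add (iforce'.const_mul (α ^ 2))).const_mul 2
  have i2 := (iL2.add (iH1.const_mul (α ^ 2))).const_mul (2 * β)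
  have i3 := iH1.const_mul (2 * ν)
  have i4 := iH2.const_mul (2 * ν * α ^ 2)
  rw [eE t ht, eE 0 le_rfl, intervalIntegral.integral_congr fun s hs => erate s
      (by rw [uIcc_of_le hT.le] at hs; exact hs.1),
    intervalIntegral.integral_sub ((i1.sub i2).sub i3) i4,
    intervalIntegral.integral_sub (i1.sub i2) i3, intervalIntegral.integral_sub i1 i2] at hbal
  simp only [intervalIntegral.integral_const_mul] at hbal
  rw [show sol.u 0 = u₀ from funext sol.init] at hbal
  linarith

end
end

section
/- Let (u₁, N₁, p₁) and (u₂, N₂, p₂) be two classical solutions of the damped Navier–Stokes–Bardina equations with the same initial datum u₀ and the same force f. Then u₁(t,x) = u₂(t,x) for all t ≥ 0 and all x ∈ ℝ³. -/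
open MeasureTheory Set

noncomputable section

open scoped SchwartzMap LineDeriv

/-- The `j`-th standard basis vector of `V3`. -/
abbrev basisVec (j : Fin 3) : V3 := Pi.single j 1

lemma integrable_schwartz_mul (f g : 𝓢(V3, ℝ)) : Integrable (fun x => f x * g x) :=
  (SchwartzMap.pairing (ContinuousLinearMap.mul ℝ ℝ) f g).integrable

/-- The `L²` pairing of scalar Schwartz functions as a bilinear form. -/
def l2Form : 𝓢(V3, ℝ) →ₗ[ℝ] 𝓢(V3, ℝ) →ₗ[ℝ] ℝ :=
  LinearMap.mk₂ ℝ (fun f g => ∫ x, f x * g x)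
    (fun f₁ f₂ g => by
      simp only [add_apply, add_mul]
      exact integral_add (integrable_schwartz_mul _ _) (integrable_schwartz_mul _ _))
    (fun c f g => by
      simp only [smul_apply, smul_eq_mul, mul_assoc]
      exact integral_const_mul _ _)
    (fun f g₁ g₂ => by
      simp only [add_apply, mul_add]
      exact integral_add (integrable_schwartz_mul _ _) (integrable_schwartz_mul _ _))
    (fun c f g => by
      simp only [smul_apply, smul_eq_mul, mul_left_comm _ c]
      exact integral_const_mul _ _)

lemma l2Form_apply (f g : 𝓢(V3, ℝ)) : l2Form f g = ∫ x, f x * g x := rfl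

lemma l2Form_comm (f g : 𝓢(V3, ℝ)) : l2Form f g = l2Form g f := by
  simp only [l2Form_apply, mul_comm]

lemma l2Form_self_nonneg (f : 𝓢(V3, ℝ)) : 0 ≤ l2Form f f :=
  integral_nonneg fun x => mul_self_nonneg (f x)

lemma eq_zero_of_l2Form_self (f : 𝓢(V3, ℝ)) (h : l2Form f f = 0) (x : V3) : f x = 0 := by
  rw [l2Form_apply, integral_eq_zero_iff_of_nonneg (fun x => mul_self_nonneg (f x))
    (integrable_schwartz_mul f f)] at h
  have h' := (Continuous.ae_eq_iff_eq volume (f.continuous.mul f.continuous)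
    continuous_zero).1 h
  exact mul_self_eq_zero.1 (congrFun h' x)

lemma l2Form_lineDeriv_right (f g : 𝓢(V3, ℝ)) (v : V3) :
    l2Form f (∂_{v} g) = -l2Form (∂_{v} f) g :=
  SchwartzMap.integral_mul_lineDerivOp_right_eq_neg_left f g v

lemma two_mul_l2Form_le (f g : 𝓢(V3, ℝ)) (c : ℝ) :
    2 * c * l2Form f g ≤ l2Form f f + c ^ 2 * l2Form g g := by
  have h := l2Form_self_nonneg (f - c • g)
  simp only [map_sub, map_smul, LinearMap.sub_apply, LinearMap.smul_apply, smul_eq_mul,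
    l2Form_comm g f] at h
  linarith

/-- The filter `(1 - α²Δ)⁻¹` is a contraction of `L²`. -/
lemma l2Form_self_le_of_filter (α : ℝ) (M : 𝓢(V3, ℝ)) :
    l2Form M M ≤ l2Form (M - α ^ 2 • ∑ j, ∂_{basisVec j} (∂_{basisVec j} M))
      (M - α ^ 2 • ∑ j, ∂_{basisVec j} (∂_{basisVec j} M)) := by
  set F := M - α ^ 2 • ∑ j, ∂_{basisVec j} (∂_{basisVec j} M) with hF
  have h1 : l2Form M F = l2Form M M
      + α ^ 2 * ∑ j, l2Form (∂_{basisVec j} M) (∂_{basisVec j} M) := by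
    simp only [hF, map_sub, map_smul, map_sum, smul_eq_mul, l2Form_lineDeriv_right M,
      Finset.sum_neg_distrib]
    ring
  have h2 : 0 ≤ α ^ 2 * ∑ j, l2Form (∂_{basisVec j} M) (∂_{basisVec j} M) :=
    mul_nonneg (sq_nonneg α) (Finset.sum_nonneg fun j _ => l2Form_self_nonneg _)
  have h3 := two_mul_l2Form_le M F 1
  linarith

/-- Energy estimate for the difference of two solutions at a fixed time. -/
lemma energy_estimate {α β ν C : ℝ} (hβ : 0 < β) (hν : 0 < ν)
    (W M : Fin 3 → 𝓢(V3, ℝ)) (Q : 𝓢(V3, ℝ)) (a : Fin 3 → Fin 3 → V3 → ℝ)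
    (b : Fin 3 → V3 → ℝ)
    (hdiv : ∑ j, ∂_{basisVec j} (W j) = 0)
    (hfilter : ∀ i x, (M i - α ^ 2 • ∑ j, ∂_{basisVec j} (∂_{basisVec j} (M i))) x
      = ∑ j, (W j x * a j i x + b j x * (∂_{basisVec j} (W i)) x))
    (ha : ∀ j i x, |a j i x| ≤ C) (hb : ∀ j x, |b j x| ≤ C) :
    ∑ i, l2Form (W i) (-M i + ν • ∑ j, ∂_{basisVec j} (∂_{basisVec j} (W i))
        - ∂_{basisVec i} Q - β • W i)
      ≤ (9 * (C ^ 2 + 1) / ν + ν) * ∑ i, l2Form (W i) (W i) := by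
  set F := fun i => M i - α ^ 2 • ∑ j, ∂_{basisVec j} (∂_{basisVec j} (M i)) with hF
  set S := ∑ i, l2Form (W i) (W i) with hS
  set D := ∑ i, ∑ j, l2Form (∂_{basisVec j} (W i)) (∂_{basisVec j} (W i)) with hD
  have hS0 : 0 ≤ S := Finset.sum_nonneg fun i _ => l2Form_self_nonneg _
  have hD0 : 0 ≤ D :=
    Finset.sum_nonneg fun i _ => Finset.sum_nonneg fun j _ => l2Form_self_nonneg _
  have hQ : ∑ i, l2Form (W i) (∂_{basisVec i} Q) = 0 := by
    simp only [l2Form_lineDeriv_right]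
    rw [Finset.sum_neg_distrib, ← LinearMap.sum_apply, ← map_sum, hdiv]
    simp
  have hFi (i : Fin 3) : l2Form (F i) (F i) ≤ 6 * C ^ 2 *
      (S + ∑ j, l2Form (∂_{basisVec j} (W i)) (∂_{basisVec j} (W i))) := by
    simp only [hS, l2Form_apply]
    rw [← integral_finsetSum _ fun j _ => integrable_schwartz_mul _ _,
      ← integral_finsetSum _ fun j _ => integrable_schwartz_mul _ _,
      ← integral_add (integrable_finsetSum _ fun j _ => integrable_schwartz_mul _ _)
        (integrable_finsetSum _ fun j _ => integrable_schwartz_mul _ _),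
      ← integral_const_mul]
    refine integral_mono (integrable_schwartz_mul _ _)
      (((integrable_finsetSum _ fun j _ => integrable_schwartz_mul _ _).add
        (integrable_finsetSum _ fun j _ => integrable_schwartz_mul _ _)).const_mul _) fun x => ?_
    have key (y z : ℝ) (hz : |z| ≤ C) : (y * z) ^ 2 ≤ C ^ 2 * (y * y) := by
      have : z ^ 2 ≤ C ^ 2 := sq_le_sq' (by linarith [(abs_le.1 hz).1]) (abs_le.1 hz).2
      nlinarith [sq_nonneg y]
    have k1 (j : Fin 3) := key (W j x) (a j i x) (ha j i x)
    have k2 (j : Fin 3) := key ((∂_{basisVec j} (W i)) x) (b j x) (hb j x)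
    have hx := hfilter i x
    change F i x = _ at hx
    change F i x * F i x ≤ _
    rw [hx, ← sq]
    have cs := sq_sum_le_card_mul_sum_sq (s := (Finset.univ : Finset (Fin 3)))
      (f := fun j => W j x * a j i x + b j x * (∂_{basisVec j} (W i)) x)
    refine cs.trans ?_
    simp only [Finset.card_univ, Fintype.card_fin, Nat.cast_ofNat]
    rw [← Finset.sum_add_distrib, Finset.mul_sum, Finset.mul_sum]
    refine Finset.sum_le_sum fun j _ => ?_
    have := k1 j
    have := k2 j
    nlinarith [sq_nonneg (W j x * a j i x - b j x * (∂_{basisVec j} (W i)) x)]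
  have hFS : ∑ i, l2Form (F i) (F i) ≤ 18 * C ^ 2 * (S + D) := by
    refine (Finset.sum_le_sum fun i _ => hFi i).trans ?_
    rw [← Finset.mul_sum, Finset.sum_add_distrib, Finset.sum_const, ← hD]
    simp only [Finset.card_univ, Fintype.card_fin, nsmul_eq_mul, Nat.cast_ofNat]
    nlinarith [mul_nonneg (sq_nonneg C) hD0]
  have hM : ∑ i, l2Form (M i) (M i) ≤ 18 * C ^ 2 * (S + D) :=
    (Finset.sum_le_sum fun i _ => l2Form_self_le_of_filter α (M i)).trans hFS
  have hlhs : ∑ i, l2Form (W i) (-M i + ν • ∑ j, ∂_{basisVec j} (∂_{basisVec j} (W i))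
        - ∂_{basisVec i} Q - β • W i) = -∑ i, l2Form (W i) (M i) - ν * D - β * S := by
    simp only [map_sub, map_add, map_neg, map_smul, map_sum, smul_eq_mul,
      Finset.sum_sub_distrib, Finset.sum_add_distrib, hQ, Finset.sum_neg_distrib,
      ← Finset.mul_sum]
    simp only [l2Form_lineDeriv_right (W _) (∂_{basisVec _} (W _)), Finset.sum_neg_distrib]
    simp only [hS, hD]
    ring
  rw [hlhs]
  set c := ν / (9 * (C ^ 2 + 1)) with hc
  have hc0 : 0 < c := by positivity
  have hWM : -(2 * c * ∑ i, l2Form (W i) (M i)) ≤ S + c ^ 2 * ∑ i, l2Form (M i) (M i) := by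
    rw [hS, Finset.mul_sum, Finset.mul_sum, ← Finset.sum_add_distrib, ← Finset.sum_neg_distrib]
    refine Finset.sum_le_sum fun i _ => ?_
    have := two_mul_l2Form_le (W i) (M i) (-c)
    linarith
  have hcν : 9 * (C ^ 2 + 1) / ν = 1 / c := by rw [hc, one_div_div]
  have hcC : c * (9 * (C ^ 2 + 1)) = ν := by rw [hc]; field_simp
  rw [hcν]
  have h1 : c * C ^ 2 * 9 ≤ ν := by nlinarith
  have h2 : -∑ i, l2Form (W i) (M i) ≤ 1 / c * S + ν * (S + D) := by
    have : c * -∑ i, l2Form (W i) (M i) ≤ c * (1 / c * S + ν * (S + D)) := by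
      have e : c * (1 / c * S + ν * (S + D)) = S + c * (ν * (S + D)) := by field_simp
      rw [e]
      have h3 := mul_le_mul_of_nonneg_left hM (sq_nonneg c)
      have h4 := mul_le_mul_of_nonneg_left h1 (mul_nonneg hc0.le (add_nonneg hS0 hD0))
      nlinarith
    exact le_of_mul_le_mul_left this hc0
  nlinarith [mul_nonneg hβ.le hS0]

/-- The `i`-th component of a vector-valued Schwartz function. -/
def schwartzComp (i : Fin 3) : 𝓢(V3, Fin 3 → ℝ) →L[ℝ] 𝓢(V3, ℝ) :=
  SchwartzMap.postcompCLM (ContinuousLinearMap.proj i)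

lemma schwartzComp_apply (i : Fin 3) (U : 𝓢(V3, Fin 3 → ℝ)) (x : V3) :
    schwartzComp i U x = U x i := rfl

lemma pd_coe (j : Fin 3) (U : 𝓢(V3, Fin 3 → ℝ)) : pd j ⇑U = ⇑(∂_{basisVec j} U : 𝓢(V3, Fin 3 → ℝ)) := by
  ext1 x
  rw [SchwartzMap.lineDerivOp_apply_eq_fderiv]
  rfl

lemma pdS_coe (j : Fin 3) (P : 𝓢(V3, ℝ)) : pdS j ⇑P = ⇑(∂_{basisVec j} P : 𝓢(V3, ℝ)) := by
  ext1 x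
  rw [SchwartzMap.lineDerivOp_apply_eq_fderiv]
  rfl

lemma lineDeriv_schwartzComp (i : Fin 3) (v : V3) (U : 𝓢(V3, Fin 3 → ℝ)) :
    ∂_{v} (schwartzComp i U) = schwartzComp i (∂_{v} U) := by
  ext x
  rw [schwartzComp_apply, SchwartzMap.lineDerivOp_apply_eq_fderiv,
    SchwartzMap.lineDerivOp_apply_eq_fderiv]
  have h := (ContinuousLinearMap.proj (R := ℝ) (φ := fun _ : Fin 3 => ℝ) i).hasFDerivAt.comp x
    (U.differentiableAt (x := x)).hasFDerivAt
  exact congrArg (fun L : V3 →L[ℝ] ℝ => L v) h.fderiv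

namespace SchwartzLocBdd

variable {F : Type*} [NormedAddCommGroup F] [NormedSpace ℝ F] {g : ℝ → V3 → F}

lemma exists_slice (hg : SchwartzLocBdd g) {t : ℝ} (ht : 0 ≤ t) :
    ∃ U : 𝓢(V3, F), ⇑U = g t := by
  have hs : ContDiff ℝ (⊤ : ℕ∞) (g t) := by
    rw [← contDiffOn_univ]
    exact hg.1.comp (g := fun q : ℝ × V3 => g q.1 q.2) (f := fun x : V3 => (t, x))
      (contDiff_const.prodMk contDiff_id).contDiffOn
      fun x _ => ⟨ht, mem_univ x⟩
  refine ⟨⟨g t, hs, fun k n => ?_⟩, rfl⟩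
  obtain ⟨C, hC⟩ := hg.2 (t + 1) (by linarith) k n
  exact ⟨C, hC t ⟨ht, by linarith⟩⟩

lemma exists_norm_le (hg : SchwartzLocBdd g) {T : ℝ} (hT : 0 < T) :
    ∃ C, ∀ t ∈ Icc 0 T, ∀ x, ‖g t x‖ ≤ C := by
  obtain ⟨C, hC⟩ := hg.2 T hT 0 0
  exact ⟨C, fun t ht x => by simpa using hC t ht x⟩

lemma exists_norm_fderiv_le (hg : SchwartzLocBdd g) {T : ℝ} (hT : 0 < T) :
    ∃ C, ∀ t ∈ Icc 0 T, ∀ x, ‖fderiv ℝ (g t) x‖ ≤ C := by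
  obtain ⟨C, hC⟩ := hg.2 T hT 0 1
  exact ⟨C, fun t ht x => by
    simpa [norm_iteratedFDeriv_one] using hC t ht x⟩

lemma exists_norm_fderiv_fderiv_le (hg : SchwartzLocBdd g) {T : ℝ} (hT : 0 < T) :
    ∃ C, ∀ t ∈ Icc 0 T, ∀ x, ‖fderiv ℝ (fderiv ℝ (g t)) x‖ ≤ C := by
  obtain ⟨C, hC⟩ := hg.2 T hT 0 2
  refine ⟨C, fun t ht x => ?_⟩
  have := hC t ht x
  rwa [pow_zero, one_mul, ← norm_iteratedFDeriv_fderiv, norm_iteratedFDeriv_one] at this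

/-- Uniform decay of order four, in a form that is integrable on `V3`. -/
lemma exists_norm_le_rpow (hg : SchwartzLocBdd g) {T : ℝ} (hT : 0 < T) :
    ∃ C, ∀ t ∈ Icc 0 T, ∀ x, ‖g t x‖ ≤ C * (1 + ‖x‖) ^ (-4 : ℝ) := by
  obtain ⟨C₀, h₀⟩ := hg.2 T hT 0 0
  obtain ⟨C₄, h₄⟩ := hg.2 T hT 4 0
  refine ⟨8 * (C₀ + C₄), fun t ht x => ?_⟩
  have h0 := h₀ t ht x
  have h4 := h₄ t ht x
  simp only [norm_iteratedFDeriv_zero, pow_zero, one_mul] at h0 h4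
  have hx : (0 : ℝ) < 1 + ‖x‖ := by positivity
  rw [Real.rpow_neg hx.le, show (4 : ℝ) = ((4 : ℕ) : ℝ) by norm_num, Real.rpow_natCast,
    ← div_eq_mul_inv, le_div_iff₀ (by positivity)]
  have hp : (1 + ‖x‖) ^ 4 ≤ 8 * (1 + ‖x‖ ^ 4) := by
    have := add_pow_le (zero_le_one' ℝ) (norm_nonneg x) 4
    norm_num at this
    linarith
  nlinarith [mul_le_mul_of_nonneg_left hp (norm_nonneg (g t x))]

end SchwartzLocBdd

lemma lineDerivOp_sub {F : Type*} [NormedAddCommGroup F] [NormedSpace ℝ F] (v : V3)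
    (f g : 𝓢(V3, F)) : (∂_{v} (f - g) : 𝓢(V3, F)) = ∂_{v} f - ∂_{v} g :=
  map_sub (LineDeriv.lineDerivOpCLM ℝ 𝓢(V3, F) v) f g

lemma norm_basisVec (j : Fin 3) : ‖basisVec j‖ = 1 := by simp [basisVec, Pi.norm_single]

lemma abs_pd_le (j i : Fin 3) (g : V3 → Fin 3 → ℝ) (x : V3) :
    |pd j g x i| ≤ ‖fderiv ℝ g x‖ := by
  refine (norm_le_pi_norm (pd j g x) i).trans ?_
  have h := (fderiv ℝ g x).le_opNorm (basisVec j)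
  rwa [norm_basisVec, mul_one] at h

lemma abs_pdS_le (j : Fin 3) (g : V3 → ℝ) (x : V3) :
    |pdS j g x| ≤ ‖fderiv ℝ g x‖ := by
  have h := (fderiv ℝ g x).le_opNorm (basisVec j)
  rwa [norm_basisVec, mul_one] at h

lemma abs_pd_pd_le (j k i : Fin 3) (U : 𝓢(V3, Fin 3 → ℝ)) (x : V3) :
    |pd j (pd k U) x i| ≤ ‖fderiv ℝ (fderiv ℝ U) x‖ := by
  refine (abs_pd_le j i _ x).trans ?_
  have hd : DifferentiableAt ℝ (fderiv ℝ U) x :=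
    ((U.smooth 2).fderiv_right (m := 1) (by norm_num)).differentiable (by norm_num) x
  have h : fderiv ℝ (pd k U) x = (fderiv ℝ (fderiv ℝ U) x).flip (basisVec k) := by
    unfold pd
    rw [fderiv_clm_apply hd (differentiableAt_const _)]
    simp
  rw [h]
  have := (fderiv ℝ (fderiv ℝ U) x).flip.le_opNorm (basisVec k)
  rwa [norm_basisVec, mul_one, ContinuousLinearMap.opNorm_flip] at this

namespace ClassicalSolution

variable {α β ν : ℝ} {u₀ f : V3 → Fin 3 → ℝ}

/-- The one-sided time derivative of the velocity. -/
def velDeriv (sol : ClassicalSolution α β ν u₀ f) (t : ℝ) (x : V3) (i : Fin 3) : ℝ :=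
  derivWithin (fun s => sol.u s x i) (Ici (0 : ℝ)) t

lemma contDiffOn_u (sol : ClassicalSolution α β ν u₀ f) (x : V3) (i : Fin 3) :
    ContDiffOn ℝ (⊤ : ℕ∞) (fun s => sol.u s x i) (Ici (0 : ℝ)) := by
  have h := sol.reg_u.1.comp (g := fun q : ℝ × V3 => sol.u q.1 q.2)
    (f := fun s : ℝ => (s, x)) (s := Ici (0 : ℝ))
    (contDiff_id.prodMk contDiff_const).contDiffOn fun s hs => ⟨hs, mem_univ x⟩
  exact contDiffOn_pi.1 h i

lemma hasDerivAt_u (sol : ClassicalSolution α β ν u₀ f) {t : ℝ} (ht : 0 < t) (x : V3)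
    (i : Fin 3) : HasDerivAt (fun s => sol.u s x i) (sol.velDeriv t x i) t :=
  (((sol.contDiffOn_u x i).differentiableOn (by simp)) t ht.le).hasDerivWithinAt.hasDerivAt
    (Ici_mem_nhds ht)

lemma exists_abs_velDeriv_le (sol : ClassicalSolution α β ν u₀ f) (hf : IsForce f) {T : ℝ}
    (hT : 0 < T) : ∃ C, ∀ t ∈ Icc 0 T, ∀ x i, |sol.velDeriv t x i| ≤ C := by
  obtain ⟨Cu, hu⟩ := sol.reg_u.exists_norm_le hT
  obtain ⟨Cuu, huu⟩ := sol.reg_u.exists_norm_fderiv_fderiv_le hT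
  obtain ⟨CN, hN⟩ := sol.reg_N.exists_norm_le hT
  obtain ⟨Cp, hp⟩ := sol.reg_p.exists_norm_fderiv_le hT
  obtain ⟨Cf, hf⟩ := hf.1.2 0 0
  refine ⟨Cf + |β| * Cu + CN + |ν| * (3 * Cuu) + Cp, fun t ht x i => ?_⟩
  have hm := sol.momentum t ht.1 x i
  change sol.velDeriv t x i + _ - _ + _ = _ at hm
  have e : sol.velDeriv t x i = f x i - β * sol.u t x i - sol.N t x i
      + ν * (∑ j, pd j (pd j (sol.u t)) x i) - pdS i (sol.p t) x := by linarith
  have h1 : |f x i| ≤ Cf := (norm_le_pi_norm (f x) i).trans (by simpa using hf x)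
  have h2 : |β * sol.u t x i| ≤ |β| * Cu := by
    rw [abs_mul]
    exact mul_le_mul_of_nonneg_left ((norm_le_pi_norm (sol.u t x) i).trans (hu t ht x))
      (abs_nonneg β)
  have h3 : |sol.N t x i| ≤ CN := (norm_le_pi_norm (sol.N t x) i).trans (hN t ht x)
  have h4 : |ν * (∑ j, pd j (pd j (sol.u t)) x i)| ≤ |ν| * (3 * Cuu) := by
    rw [abs_mul]
    refine mul_le_mul_of_nonneg_left ((Finset.abs_sum_le_sum_abs _ _).trans ?_) (abs_nonneg ν)
    obtain ⟨U, hU⟩ := sol.reg_u.exists_slice ht.1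
    refine (Finset.sum_le_card_nsmul _ _ Cuu fun j _ => ?_).trans (by simp)
    rw [← hU]
    exact (abs_pd_pd_le j j i U x).trans (by rw [hU]; exact huu t ht x)
  have h5 : |pdS i (sol.p t) x| ≤ Cp := (abs_pdS_le i _ x).trans (hp t ht x)
  rw [e]
  simp only [abs_le] at *
  constructor <;> linarith [h1.1, h1.2, h2.1, h2.2, h3.1, h3.2, h4.1, h4.2, h5.1, h5.2]

/-- Energy estimate for the difference of two solutions, with its Schwartz representatives. -/
lemma exists_energy_estimate (hβ : 0 < β) (hν : 0 < ν) (sol₁ sol₂ : ClassicalSolution α β ν u₀ f)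
    {t C : ℝ} (ht : 0 ≤ t) (h₁ : ∀ x, ‖fderiv ℝ (sol₁.u t) x‖ ≤ C)
    (h₂ : ∀ x, ‖sol₂.u t x‖ ≤ C) :
    ∃ W R : Fin 3 → 𝓢(V3, ℝ), (∀ i x, W i x = sol₁.u t x i - sol₂.u t x i) ∧
      (∀ i x, R i x = sol₁.velDeriv t x i - sol₂.velDeriv t x i) ∧
      ∑ i, l2Form (W i) (R i) ≤ (9 * (C ^ 2 + 1) / ν + ν) * ∑ i, l2Form (W i) (W i) := by
  obtain ⟨U₁, hU₁⟩ := sol₁.reg_u.exists_slice ht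
  obtain ⟨U₂, hU₂⟩ := sol₂.reg_u.exists_slice ht
  obtain ⟨N₁, hN₁⟩ := sol₁.reg_N.exists_slice ht
  obtain ⟨N₂, hN₂⟩ := sol₂.reg_N.exists_slice ht
  obtain ⟨P₁, hP₁⟩ := sol₁.reg_p.exists_slice ht
  obtain ⟨P₂, hP₂⟩ := sol₂.reg_p.exists_slice ht
  have hd₁ := sol₁.divFree t ht
  have hd₂ := sol₂.divFree t ht
  have hn₁ := sol₁.filter t ht
  have hn₂ := sol₂.filter t ht
  have hm₁ := sol₁.momentum t ht
  have hm₂ := sol₂.momentum t ht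
  change ∀ x i, sol₁.velDeriv t x i + _ - _ + _ = _ at hm₁
  change ∀ x i, sol₂.velDeriv t x i + _ - _ + _ = _ at hm₂
  rw [← hU₁] at h₁ hd₁ hn₁ hm₁ ⊢
  rw [← hU₂] at h₂ hd₂ hn₂ hm₂ ⊢
  rw [← hN₁] at hn₁ hm₁
  rw [← hN₂] at hn₂ hm₂
  rw [← hP₁] at hm₁
  rw [← hP₂] at hm₂
  refine ⟨fun i => schwartzComp i (U₁ - U₂), _, fun i x => rfl, ?_,
    energy_estimate (α := α) hβ hν _ (fun i => schwartzComp i (N₁ - N₂)) (P₁ - P₂)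
      (fun j i x => pd j U₁ x i) (fun j x => U₂ x j) ?_ ?_
      (fun j i x => (abs_pd_le j i U₁ x).trans (h₁ x))
      (fun j x => (norm_le_pi_norm (U₂ x) j).trans (h₂ x))⟩
  · intro i x
    have e₁ := hm₁ x i
    have e₂ := hm₂ x i
    simp only [pd_coe, pdS_coe] at e₁ e₂
    simp only [lineDeriv_schwartzComp, lineDerivOp_sub, sub_apply, add_apply, neg_apply,
      smul_apply, smul_eq_mul, sum_apply, schwartzComp_apply, Pi.sub_apply,
      Finset.sum_sub_distrib]
    linarith
  · ext x
    have e₁ := hd₁ x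
    have e₂ := hd₂ x
    simp only [pd_coe] at e₁ e₂
    simp only [lineDeriv_schwartzComp, lineDerivOp_sub, sub_apply, sum_apply,
      schwartzComp_apply, Pi.sub_apply, Finset.sum_sub_distrib, e₁, e₂]
    simp
  · intro i x
    have e₁ := hn₁ x i
    have e₂ := hn₂ x i
    simp only [pd_coe] at e₁ e₂ ⊢
    simp only [lineDeriv_schwartzComp, lineDerivOp_sub, sub_apply, smul_apply,
      smul_eq_mul, sum_apply, schwartzComp_apply, Pi.sub_apply,
      Finset.sum_sub_distrib]
    trans (∑ j, U₁ x j * (∂_{basisVec j} U₁) x i) - ∑ j, U₂ x j * (∂_{basisVec j} U₂) x i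
    · linarith
    · rw [← Finset.sum_sub_distrib]
      exact Finset.sum_congr rfl fun j _ => by ring

end ClassicalSolution

/-- Uniqueness of classical solutions of the damped Navier–Stokes–Bardina equations. -/
theorem uniqueness (α β ν : ℝ) (hα : 0 < α) (hβ : 0 < β) (hν : 0 < ν)
    (u₀ f : V3 → Fin 3 → ℝ) (hf : IsForce f)
    (sol₁ sol₂ : ClassicalSolution α β ν u₀ f) :
    ∀ t ≥ (0:ℝ), ∀ x : V3, sol₁.u t x = sol₂.u t x := by
  intro t₀ ht₀ x₀
  obtain ⟨T, hT, htT⟩ : ∃ T : ℝ, 0 < T ∧ t₀ < T := ⟨t₀ + 1, by linarith, by linarith⟩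
  obtain ⟨B₁, hB₁⟩ := sol₁.reg_u.exists_norm_fderiv_le hT
  obtain ⟨B₂, hB₂⟩ := sol₂.reg_u.exists_norm_le hT
  obtain ⟨A₁, hA₁⟩ := sol₁.reg_u.exists_norm_le_rpow hT
  obtain ⟨A₂, hA₂⟩ := sol₂.reg_u.exists_norm_le_rpow hT
  obtain ⟨D₁, hD₁⟩ := sol₁.exists_abs_velDeriv_le hf hT
  obtain ⟨D₂, hD₂⟩ := sol₂.exists_abs_velDeriv_le hf hT
  set w : ℝ → V3 → Fin 3 → ℝ := fun t x i => sol₁.u t x i - sol₂.u t x i with hw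
  set r : ℝ → V3 → Fin 3 → ℝ := fun t x i => sol₁.velDeriv t x i - sol₂.velDeriv t x i with hr
  set E : ℝ → ℝ := fun t => ∫ x, ∑ i, w t x i * w t x i with hE
  set K := 9 * ((max B₁ B₂) ^ 2 + 1) / ν + ν with hK
  have main (t : ℝ) (ht : t ∈ Icc 0 T) : ∃ W R : Fin 3 → 𝓢(V3, ℝ),
      (∀ i x, W i x = w t x i) ∧ (∀ i x, R i x = r t x i) ∧
      ∑ i, l2Form (W i) (R i) ≤ K * ∑ i, l2Form (W i) (W i) :=
    sol₁.exists_energy_estimate hβ hν sol₂ ht.1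
      (fun x => (hB₁ t ht x).trans (le_max_left _ _))
      (fun x => (hB₂ t ht x).trans (le_max_right _ _))
  have hsum (W R : Fin 3 → 𝓢(V3, ℝ)) :
      ∫ x, ∑ i, W i x * R i x = ∑ i, l2Form (W i) (R i) :=
    integral_finsetSum _ fun i _ => integrable_schwartz_mul _ _
  have hmeas (t : ℝ) (ht : t ∈ Icc 0 T) :
      AEStronglyMeasurable (fun x => ∑ i, w t x i * w t x i) (volume : Measure V3) := by
    obtain ⟨W, R, hW, -, -⟩ := main t ht
    simp only [← hW]
    exact (integrable_finsetSum _ fun i _ => integrable_schwartz_mul _ _).aestronglyMeasurable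
  have hdecay (t : ℝ) (ht : t ∈ Icc 0 T) (x : V3) (i : Fin 3) :
      |w t x i| ≤ (A₁ + A₂) * (1 + ‖x‖) ^ (-4 : ℝ) := by
    have h1 := (norm_le_pi_norm (sol₁.u t x) i).trans (hA₁ t ht x)
    have h2 := (norm_le_pi_norm (sol₂.u t x) i).trans (hA₂ t ht x)
    rw [add_mul]
    exact (abs_sub _ _).trans (add_le_add h1 h2)
  have hrb (t : ℝ) (ht : t ∈ Icc 0 T) (x : V3) (i : Fin 3) : |r t x i| ≤ D₁ + D₂ :=
    (abs_sub _ _).trans (add_le_add (hD₁ t ht x i) (hD₂ t ht x i))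
  have hint : Integrable (fun x : V3 => (1 + ‖x‖) ^ (-4 : ℝ)) :=
    integrable_one_add_norm (by simp; norm_num)
  have hA0 : 0 ≤ A₁ + A₂ := by
    simpa using (abs_nonneg _).trans (hdecay 0 ⟨le_rfl, hT.le⟩ 0 0)
  have hdec1 (x : V3) : (1 + ‖x‖) ^ (-4 : ℝ) ≤ 1 :=
    Real.rpow_le_one_of_one_le_of_nonpos (by linarith [norm_nonneg x]) (by norm_num)
  have hcont : ContinuousOn E (Icc 0 T) := by
    refine continuousOn_of_dominated (bound := fun x =>
      3 * ((A₁ + A₂) * (A₁ + A₂)) * (1 + ‖x‖) ^ (-4 : ℝ)) hmeas (fun t ht => ae_of_all _ fun x => ?_)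
      (hint.const_mul _) (ae_of_all _ fun x => ?_)
    · refine (norm_sum_le _ _).trans ((Finset.sum_le_card_nsmul _ _
        ((A₁ + A₂) * (A₁ + A₂) * (1 + ‖x‖) ^ (-4 : ℝ)) fun i _ => ?_).trans_eq ?_)
      · rw [norm_mul, Real.norm_eq_abs, mul_assoc, mul_comm (A₁ + A₂)]
        have h1 := hdecay t ht x i
        refine mul_le_mul h1 (h1.trans (mul_le_of_le_one_right hA0 (hdec1 x)))
          (abs_nonneg _) ((abs_nonneg _).trans h1) |>.trans_eq ?_
        ring
      · simp
        ring
    · refine continuousOn_finsetSum _ fun i _ => ?_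
      have h : ContinuousOn (fun t => w t x i) (Icc 0 T) :=
        ((sol₁.contDiffOn_u x i).continuousOn.sub (sol₂.contDiffOn_u x i).continuousOn).mono
          Icc_subset_Ici_self
      exact h.mul h
  have hderiv (t : ℝ) (ht : t ∈ Ioo 0 T) :
      HasDerivAt E (∫ x, ∑ i, 2 * (w t x i * r t x i)) t := by
    obtain ⟨W, R, hW, hR, -⟩ := main t (Ioo_subset_Icc_self ht)
    refine (hasDerivAt_integral_of_dominated_loc_of_deriv_le (s := Ioo 0 T)
      (F' := fun t x => ∑ i, 2 * (w t x i * r t x i))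
      (bound := fun x => 6 * ((A₁ + A₂) * (D₁ + D₂)) * (1 + ‖x‖) ^ (-4 : ℝ))
      (Ioo_mem_nhds ht.1 ht.2) ?_ ?_ ?_ (ae_of_all _ fun x s hs => ?_) (hint.const_mul _)
      (ae_of_all _ fun x s hs => ?_)).2
    · filter_upwards [Ioo_mem_nhds ht.1 ht.2] with s hs using hmeas s (Ioo_subset_Icc_self hs)
    · simp only [← hW]
      exact integrable_finsetSum _ fun i _ => integrable_schwartz_mul _ _
    · simp only [← hW, ← hR]
      exact (integrable_finsetSum _ fun i _ =>
        (integrable_schwartz_mul _ _).const_mul 2).aestronglyMeasurable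
    · have hs' := Ioo_subset_Icc_self hs
      refine (norm_sum_le _ _).trans ((Finset.sum_le_card_nsmul _ _
        (2 * (((A₁ + A₂) * (1 + ‖x‖) ^ (-4 : ℝ)) * (D₁ + D₂))) fun i _ => ?_).trans_eq ?_)
      · rw [norm_mul, norm_mul, Real.norm_ofNat]
        refine mul_le_mul_of_nonneg_left ?_ zero_le_two
        exact mul_le_mul (hdecay s hs' x i) (hrb s hs' x i) (abs_nonneg _)
          ((abs_nonneg _).trans (hdecay s hs' x i))
      · simp
        ring
    · refine HasDerivAt.fun_sum fun i _ => ?_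
      have h : HasDerivAt (fun s => w s x i) (r s x i) s :=
        (sol₁.hasDerivAt_u hs.1 x i).sub (sol₂.hasDerivAt_u hs.1 x i)
      exact (h.fun_mul h).congr_deriv (by ring)
  have hle (t : ℝ) (ht : t ∈ Ioo 0 T) :
      ∫ x, ∑ i, 2 * (w t x i * r t x i) ≤ 2 * K * E t := by
    obtain ⟨W, R, hW, hR, hWR⟩ := main t (Ioo_subset_Icc_self ht)
    simp only [hE, ← hW, ← hR, ← Finset.mul_sum, integral_const_mul, hsum]
    linarith
  have hanti : AntitoneOn (fun t => Real.exp (-(2 * K) * t) * E t) (Icc 0 T) := by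
    have hd (t : ℝ) (ht : t ∈ Ioo 0 T) :=
      (((hasDerivAt_id t).const_mul (-(2 * K))).exp).mul (hderiv t ht)
    refine antitoneOn_of_deriv_nonpos (convex_Icc 0 T) (by fun_prop) ?_ ?_
    · rw [interior_Icc]
      exact fun t ht => (hd t ht).differentiableAt.differentiableWithinAt
    · rw [interior_Icc]
      intro t ht
      refine (hd t ht).deriv.trans_le ?_
      have := mul_le_mul_of_nonneg_left (hle t ht) (Real.exp_pos (-(2 * K) * t)).le
      simp only [id]
      linarith
  have hE0 : E 0 = 0 := by simp [hE, hw, sol₁.init, sol₂.init]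
  have ht₀' : t₀ ∈ Icc 0 T := ⟨ht₀, htT.le⟩
  have h0 := hanti ⟨le_rfl, hT.le⟩ ht₀' ht₀
  simp only [hE0, mul_zero] at h0
  have hEt : E t₀ ≤ 0 := nonpos_of_mul_nonpos_right h0 (Real.exp_pos _)
  obtain ⟨W, R, hW, -, -⟩ := main t₀ ht₀'
  simp only [hE, ← hW, hsum] at hEt
  have hz := (Finset.sum_eq_zero_iff_of_nonneg fun i _ => l2Form_self_nonneg (W i)).1
    (le_antisymm hEt (Finset.sum_nonneg fun i _ => l2Form_self_nonneg (W i)))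
  ext i
  have h := eq_zero_of_l2Form_self (W i) (hz i (Finset.mem_univ i)) x₀
  rw [hW] at h
  exact sub_eq_zero.1 h

end
end
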